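/- For all real μ, ν with μ + ν > −1 and every ω > 0, the Abel limit of ∫₀^∞ x^μ J_ν(ωx) dx exists and equals 2^μ Γ((ν+μ+1)/2) / (ω^{μ+1} Γ((ν−μ+1)/2)), where the right-hand side is interpreted with the convention 1/Γ(z) = 0 when z is a nonpositive integer. -/

import Mathlib

open MeasureTheory Filter Set Polynomial
open scoped Classical

noncomputable section

/-- The Abel limit of `∫₀^∞ g(x) dx` is `L`: for every `s > 0` the integral
`∫₀^∞ e^{-s x} g(x) dx` converges and these integrals tend to `L` as `s → 0⁺`. -/
def HasAbelLimit (g : ℝ → ℂ) (L : ℂ) : Prop :=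
  (∀ s : ℝ, 0 < s →
    IntegrableOn (fun x : ℝ => Complex.exp (-(s : ℂ) * (x : ℂ)) * g x) (Set.Ioi 0)) ∧
  Tendsto (fun s : ℝ => ∫ x in Set.Ioi (0:ℝ), Complex.exp (-(s : ℂ) * (x : ℂ)) * g x)
    (nhdsWithin 0 (Set.Ioi 0)) (nhds L)

/-- Bessel function of the first kind of order `ν`, for `x > 0`, with the convention
`1/Γ(z) = 0` at nonpositive integers `z` (automatic since `Real.Gamma` vanishes there). -/
def besselJ (ν x : ℝ) : ℝ :=
  ∑' k : ℕ, ((-1 : ℝ) ^ k / ((k.factorial : ℝ) * Real.Gamma (ν + k + 1))) *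
    (x / 2) ^ (ν + 2 * (k : ℝ))

/-- Modified Bessel function of the second kind of order `ν`, for `x > 0`. -/
def besselK (ν x : ℝ) : ℝ :=
  ∫ t in Set.Ioi (0:ℝ), Real.exp (-x * Real.cosh t) * Real.cosh (ν * t)

/-- The weight function `w_{μ,ν}` on `(0,∞)`. -/
def weightW (μ ν : ℝ) (x : ℝ) : ℝ :=
  if ∃ m : ℤ, μ - ν = 2 * m then (1/2) * x ^ ((μ - 1)/2) * besselK ν (Real.sqrt x)
  else (1/2) * x ^ (μ/2) * besselK ν (Real.sqrt x)

/-- `0 < x_1 < ⋯ < x_n` together with positive weights `w_1, …, w_n` form an `n`-point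
Gaussian quadrature rule for `w_{μ,ν}`. -/
def IsGaussRule (μ ν : ℝ) (n : ℕ) (xs ws : Fin n → ℝ) : Prop :=
  StrictMono xs ∧ (∀ j, 0 < xs j) ∧ (∀ j, 0 < ws j) ∧
  ∀ p : Polynomial ℝ, p.natDegree ≤ 2 * n - 1 →
    ∑ j, ws j * p.eval (xs j) = ∫ x in Set.Ioi (0:ℝ), weightW μ ν x * p.eval x

/-- `κ = μ` if `μ - ν` is even and `κ = μ + 1` if `μ - ν` is odd. -/
def kappaQ (μ ν : ℕ) : ℝ := if Even (μ - ν) then (μ : ℝ) else (μ : ℝ) + 1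

/-- The boundary weights `ŵ_k⁰` of the generalized Gauss–Radau rule. -/
def wHat0 (μ ν : ℕ) {n : ℕ} (xs ws : Fin n → ℝ) (k : ℕ) : ℝ :=
  (1 / (k.factorial : ℝ)) *
    (2 ^ k * Real.Gamma (((ν : ℝ) + k + 1)/2) / Real.Gamma (((ν : ℝ) - k + 1)/2)
      - (2 / Real.pi) * Real.cos (((k : ℝ) - ν) * Real.pi / 2) *
          ∑ j, ws j * (xs j) ^ (((k : ℝ) - kappaQ μ ν)/2))

/-- The generalized Gauss–Radau rule `(Q_{2n,μ} f)(ω)`. -/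
def QRule (μ ν : ℕ) {n : ℕ} (xs ws : Fin n → ℝ) (f : ℂ → ℂ) (ω : ℝ) : ℂ :=
  (1 / (ω : ℂ)) *
    ((∑ k ∈ Finset.range μ, (wHat0 μ ν xs ws k : ℂ) / (ω : ℂ) ^ k * iteratedDeriv k f 0)
      + ∑ j, ((ws j * (xs j) ^ (-(kappaQ μ ν)/2) / Real.pi : ℝ) : ℂ) *
          (Complex.exp (-(ν : ℂ) * (Real.pi : ℂ) * Complex.I / 2) *
              f (Complex.I * (Real.sqrt (xs j) : ℂ) / (ω : ℂ))
            + Complex.exp ((ν : ℂ) * (Real.pi : ℂ) * Complex.I / 2) *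
              f (-Complex.I * (Real.sqrt (xs j) : ℂ) / (ω : ℂ))))

/-- `P` is a monic polynomial of degree `m` orthogonal with respect to `x^μ J_ν(x)`
on `(0,∞)`, all integrals taken in the Abel-limit sense. -/
def MonicOrthoBessel (μ ν : ℝ) (m : ℕ) (P : Polynomial ℂ) : Prop :=
  P.Monic ∧ P.natDegree = m ∧
  ∀ k < m, HasAbelLimit
    (fun x : ℝ => P.eval (x : ℂ) * ((x ^ ((k : ℝ) + μ) : ℝ) : ℂ) * (besselJ ν x : ℂ)) 0

/-- `φ` is the monic real polynomial of degree `m` orthogonal to all lower powers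
with respect to the weight `w_{μ,ν}` on `(0,∞)`. -/
def IsMonicOrthoW (μ ν : ℝ) (m : ℕ) (φ : Polynomial ℝ) : Prop :=
  φ.Monic ∧ φ.natDegree = m ∧
  ∀ k < m, ∫ x in Set.Ioi (0:ℝ), weightW μ ν x * φ.eval x * x ^ k = 0

/-- Coefficients of the entire function `y ↦ (√y)^{-ν} J_ν(2√y)`. -/
def besselCoeff (ν : ℝ) (k : ℕ) : ℝ :=
  (-1 : ℝ) ^ k / ((k.factorial : ℝ) * Real.Gamma (ν + k + 1))

/-- The entire part of the Bessel function: `J_ν(x) = (x/2)^ν * besselEntire ν (x²/4)`. -/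
def besselEntire (ν y : ℝ) : ℝ := ∑' k : ℕ, besselCoeff ν k * y ^ k

theorem inv_Gamma_eq_mul_inv_Gamma_add_one (z : ℝ) :
    (Real.Gamma z)⁻¹ = z * (Real.Gamma (z + 1))⁻¹ := by
  rcases eq_or_ne z 0 with rfl | hz
  · simp
  · rw [Real.Gamma_add_one hz, mul_inv, mul_inv_cancel_left₀ hz]

theorem besselCoeff_eq_mul_besselCoeff_add_one (ν : ℝ) (k : ℕ) :
    besselCoeff ν k = (ν + k + 1) * besselCoeff (ν + 1) k := by
  have h := inv_Gamma_eq_mul_inv_Gamma_add_one (ν + k + 1)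
  rw [besselCoeff, besselCoeff, div_eq_mul_inv, div_eq_mul_inv, mul_inv, mul_inv, h,
    show ν + 1 + (k : ℝ) + 1 = ν + k + 1 + 1 by ring]
  ring

theorem succ_mul_besselCoeff_succ (ν : ℝ) (k : ℕ) :
    ((k : ℝ) + 1) * besselCoeff ν (k + 1) = -besselCoeff (ν + 1) k := by
  have hk : (k : ℝ) + 1 ≠ 0 := by positivity
  simp only [besselCoeff, Nat.factorial_succ, div_eq_mul_inv, mul_inv, pow_succ]
  push_cast
  rw [show ν + ((k : ℝ) + 1) + 1 = ν + 1 + k + 1 by ring]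
  field_simp

theorem summable_besselCoeff_mul_pow (ν y : ℝ) :
    Summable fun k : ℕ => besselCoeff ν k * y ^ k := by
  have hev : ∀ᶠ k : ℕ in atTop, 2 * |y| + |ν| + 1 ≤ k :=
    tendsto_natCast_atTop_atTop.eventually_ge_atTop _
  refine summable_of_ratio_norm_eventually_le (r := 1 / 2) (by norm_num) ?_
  filter_upwards [hev] with k hk
  have hν := neg_abs_le ν
  have hy := abs_nonneg y
  have hν' := abs_nonneg ν
  have h1 := besselCoeff_eq_mul_besselCoeff_add_one ν k
  have h2 := succ_mul_besselCoeff_succ ν k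
  have h3 : besselCoeff ν k = -((ν + k + 1) * ((k : ℝ) + 1)) * besselCoeff ν (k + 1) := by
    rw [h1, ← neg_eq_iff_eq_neg.mpr h2]; ring
  rw [h3, norm_mul, norm_mul, norm_mul, norm_neg, pow_succ, norm_mul]
  simp only [Real.norm_eq_abs]
  rw [abs_of_nonneg (show 0 ≤ (ν + k + 1) * ((k : ℝ) + 1) by
    apply mul_nonneg <;> linarith)]
  have h4 : |y| ≤ 1 / 2 * ((ν + k + 1) * ((k : ℝ) + 1)) := by nlinarith
  calc |besselCoeff ν (k + 1)| * (|y ^ k| * |y|)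
      = (|besselCoeff ν (k + 1)| * |y ^ k|) * |y| := by ring
    _ ≤ (|besselCoeff ν (k + 1)| * |y ^ k|) * (1 / 2 * ((ν + k + 1) * ((k : ℝ) + 1))) := by
        gcongr
    _ = _ := by ring

theorem hasDerivAt_besselEntire (ν y : ℝ) :
    HasDerivAt (besselEntire ν) (-besselEntire (ν + 1) y) y := by
  set R : ℝ := |y| + 1 with hR
  have hR0 : 0 ≤ R := by positivity
  have key : ∀ k : ℕ, ∀ z : ℝ,
      besselCoeff ν (k + 1) * (((k + 1 : ℕ) : ℝ) * z ^ k) = -(besselCoeff (ν + 1) k * z ^ k) := by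
    intro k z
    have := succ_mul_besselCoeff_succ ν k
    push_cast
    linear_combination z ^ k * this
  have hu : Summable fun k : ℕ => ‖besselCoeff ν k * ((k : ℝ) * R ^ (k - 1))‖ := by
    rw [← summable_nat_add_iff 1]
    simp only [Nat.add_sub_cancel, key, norm_neg]
    exact (summable_besselCoeff_mul_pow (ν + 1) R).norm
  have hmem : ∀ z : ℝ, z ∈ Metric.ball (0 : ℝ) R ↔ |z| < R := by
    intro z; simp
  have h := hasDerivAt_tsum_of_isPreconnected (g := fun k z => besselCoeff ν k * z ^ k)
    (g' := fun k z => besselCoeff ν k * ((k : ℝ) * z ^ (k - 1))) (y := y) (y₀ := y)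
    hu Metric.isOpen_ball (convex_ball (0 : ℝ) R).isPreconnected
    (fun k z _ => (hasDerivAt_pow k z).const_mul _)
    (fun k z hz => by
      rw [hmem] at hz
      simp only [norm_mul, norm_pow, Real.norm_eq_abs, abs_of_nonneg hR0]
      gcongr)
    ((hmem y).2 (by rw [hR]; linarith)) (summable_besselCoeff_mul_pow ν y)
    ((hmem y).2 (by rw [hR]; linarith))
  refine h.congr_deriv ?_
  have hs : Summable fun k : ℕ => besselCoeff ν k * ((k : ℝ) * y ^ (k - 1)) := by
    rw [← summable_nat_add_iff 1]
    simp only [Nat.add_sub_cancel, key]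
    exact (summable_besselCoeff_mul_pow (ν + 1) y).neg
  rw [hs.tsum_eq_zero_add]
  simp only [Nat.add_sub_cancel, key, besselEntire, tsum_neg]
  simp

theorem besselEntire_eq (ν y : ℝ) :
    besselEntire ν y = (ν + 1) * besselEntire (ν + 1) y - y * besselEntire (ν + 2) y := by
  have h1 := summable_besselCoeff_mul_pow (ν + 1) y
  have h2 := summable_besselCoeff_mul_pow (ν + 2) y
  have hs : Summable fun k : ℕ => (k : ℝ) * besselCoeff (ν + 1) k * y ^ k := by
    refine ((summable_besselCoeff_mul_pow ν y).sub (h1.mul_left (ν + 1))).congr fun k => ?_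
    rw [besselCoeff_eq_mul_besselCoeff_add_one ν k]; ring
  have hk : ∑' k : ℕ, (k : ℝ) * besselCoeff (ν + 1) k * y ^ k = -(y * besselEntire (ν + 2) y) := by
    rw [hs.tsum_eq_zero_add, besselEntire, ← tsum_mul_left, ← tsum_neg]
    simp only [Nat.cast_zero, zero_mul, zero_add]
    refine tsum_congr fun k => ?_
    have := succ_mul_besselCoeff_succ (ν + 1) k
    rw [show ν + 1 + 1 = ν + 2 by ring] at this
    push_cast
    rw [this, pow_succ]; ring
  rw [sub_eq_add_neg, ← hk, besselEntire, besselEntire, ← tsum_mul_left,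
    ← (h1.mul_left (ν + 1)).tsum_add hs]
  refine tsum_congr fun k => ?_
  rw [besselCoeff_eq_mul_besselCoeff_add_one ν k]; ring

theorem besselJ_eq_rpow_mul_besselEntire (ν : ℝ) {x : ℝ} (hx : 0 < x) :
    besselJ ν x = (x / 2) ^ ν * besselEntire ν ((x / 2) ^ 2) := by
  rw [besselJ, besselEntire, ← tsum_mul_left]
  refine tsum_congr fun k => ?_
  rw [Real.rpow_add (by positivity), show 2 * (k : ℝ) = ((2 * k : ℕ) : ℝ) by push_cast; ring,
    Real.rpow_natCast, pow_mul, besselCoeff]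
  ring

theorem besselJ_recurrence (ν : ℝ) {x : ℝ} (hx : 0 < x) :
    besselJ ν x = 2 * (ν + 1) / x * besselJ (ν + 1) x - besselJ (ν + 2) x := by
  have hx2 : 0 < x / 2 := by positivity
  simp only [besselJ_eq_rpow_mul_besselEntire _ hx]
  rw [besselEntire_eq ν, Real.rpow_add hx2, Real.rpow_add hx2, Real.rpow_one, Real.rpow_two]
  field_simp

theorem hasDerivAt_besselJ (ν : ℝ) {x : ℝ} (hx : 0 < x) :
    HasDerivAt (besselJ ν) (ν / x * besselJ ν x - besselJ (ν + 1) x) x := by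
  have hx2 : 0 < x / 2 := by positivity
  have hlin : HasDerivAt (fun t : ℝ => t / 2) (1 / 2) x := (hasDerivAt_id x).div_const 2
  have h1 : HasDerivAt (fun t : ℝ => (t / 2) ^ ν) (1 / 2 * ν * (x / 2) ^ (ν - 1)) x :=
    hlin.rpow_const (Or.inl hx2.ne')
  have h2 : HasDerivAt (fun t : ℝ => besselEntire ν ((t / 2) ^ 2))
      (-besselEntire (ν + 1) ((x / 2) ^ 2) * (2 * (x / 2) * (1 / 2))) x := by
    refine (HasDerivAt.comp x (hasDerivAt_besselEntire ν ((x / 2) ^ 2))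
      (hlin.pow 2)).congr_deriv ?_
    simp
  have h := (h1.mul h2).congr_of_eventuallyEq (f₁ := besselJ ν) (by
    filter_upwards [lt_mem_nhds hx] with t ht using besselJ_eq_rpow_mul_besselEntire ν ht)
  refine h.congr_deriv ?_
  simp only [besselJ_eq_rpow_mul_besselEntire _ hx]
  rw [Real.rpow_add hx2, Real.rpow_sub hx2, Real.rpow_one]
  field_simp
  ring

theorem hasDerivAt_besselJ_add_one (ν : ℝ) {x : ℝ} (hx : 0 < x) :
    HasDerivAt (besselJ (ν + 1)) (besselJ ν x - (ν + 1) / x * besselJ (ν + 1) x) x := by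
  have h := hasDerivAt_besselJ (ν + 1) hx
  rw [show ν + 1 + 1 = ν + 2 by ring] at h
  refine h.congr_deriv ?_
  rw [besselJ_recurrence ν hx]
  ring

theorem continuousOn_besselJ (ν : ℝ) : ContinuousOn (besselJ ν) (Ioi 0) := fun _ hx =>
  (hasDerivAt_besselJ ν hx).continuousAt.continuousWithinAt

/-! ### Bounds -/

theorem exists_abs_besselJ_le_of_neg_one_le (ν : ℝ) (h1 : -1 ≤ ν) (h0 : ν ≤ 0) :
    ∃ C, ∀ x, 1 ≤ x → |besselJ ν x| ≤ C ∧ |besselJ (ν + 1) x| ≤ C := by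
  set E : ℝ → ℝ := fun x => besselJ ν x ^ 2 + besselJ (ν + 1) x ^ 2 with hE
  have hd : ∀ x, 0 < x → HasDerivAt E
      (2 * ν / x * besselJ ν x ^ 2 - 2 * (ν + 1) / x * besselJ (ν + 1) x ^ 2) x := by
    intro x hx
    refine (((hasDerivAt_besselJ ν hx).pow 2).add
      ((hasDerivAt_besselJ_add_one ν hx).pow 2)).congr_deriv ?_
    simp only [Nat.cast_ofNat, Nat.add_one_sub_one, pow_one]
    ring
  have hanti : AntitoneOn E (Ici 1) := by
    refine antitoneOn_of_deriv_nonpos (convex_Ici 1) (fun x hx => ?_) (fun x hx => ?_)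
      (fun x hx => ?_)
    · exact (hd x (lt_of_lt_of_le one_pos hx)).continuousAt.continuousWithinAt
    · rw [interior_Ici] at hx
      exact (hd x (lt_trans one_pos hx)).differentiableAt.differentiableWithinAt
    · rw [interior_Ici] at hx
      have hx0 : 0 < x := lt_trans one_pos hx
      rw [(hd x hx0).deriv]
      have ha : 2 * ν / x * besselJ ν x ^ 2 ≤ 0 :=
        mul_nonpos_of_nonpos_of_nonneg (div_nonpos_of_nonpos_of_nonneg (by linarith) hx0.le)
          (sq_nonneg _)
      have hb : 0 ≤ 2 * (ν + 1) / x * besselJ (ν + 1) x ^ 2 :=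
        mul_nonneg (div_nonneg (by linarith) hx0.le) (sq_nonneg _)
      linarith
  refine ⟨Real.sqrt (E 1), fun x hx => ?_⟩
  have hle : E x ≤ E 1 := hanti self_mem_Ici hx hx
  have hE' : E x = besselJ ν x ^ 2 + besselJ (ν + 1) x ^ 2 := rfl
  constructor <;> apply Real.abs_le_sqrt <;>
    nlinarith [sq_nonneg (besselJ ν x), sq_nonneg (besselJ (ν + 1) x)]

theorem abs_div_mul_sub_le {a x u v C D : ℝ} (hx : 1 ≤ x) (hu : |u| ≤ C) (hv : |v| ≤ D) :
    |a / x * u - v| ≤ |a| * C + D := by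
  have hx0 : 0 < x := by linarith
  have h : |a / x| ≤ |a| := by
    rw [abs_div, abs_of_pos hx0]; exact div_le_self (abs_nonneg _) hx
  calc |a / x * u - v| ≤ |a / x * u| + |v| := abs_sub _ _
    _ ≤ |a| * C + D := by rw [abs_mul]; gcongr

theorem exists_abs_besselJ_le (ν : ℝ) : ∃ C, ∀ x, 1 ≤ x → |besselJ ν x| ≤ C := by
  have hstep : ∀ n : ℤ, ∃ C, ∀ x, 1 ≤ x →
      |besselJ (ν - ⌈ν⌉ + n) x| ≤ C ∧ |besselJ (ν - ⌈ν⌉ + n + 1) x| ≤ C := by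
    intro n
    induction n using Int.induction_on with
    | zero =>
      have h1 := Int.ceil_lt_add_one ν
      have h2 := Int.le_ceil ν
      simpa using exists_abs_besselJ_le_of_neg_one_le (ν - ⌈ν⌉) (by linarith) (by linarith)
    | succ n ih =>
      obtain ⟨C, hC⟩ := ih
      push_cast at hC ⊢
      set θ := ν - ⌈ν⌉ + (n : ℝ) with hθ
      refine ⟨max C (|2 * (θ + 1)| * C + C), fun x hx => ?_⟩
      obtain ⟨ha, hb⟩ := hC x hx
      have hx0 : 0 < x := by linarith
      rw [show ν - ⌈ν⌉ + ((n : ℝ) + 1) = θ + 1 by rw [hθ]; ring, show θ + 1 + 1 = θ + 2 by ring]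
      refine ⟨hb.trans (le_max_left _ _), le_trans ?_ (le_max_right _ _)⟩
      rw [show besselJ (θ + 2) x = 2 * (θ + 1) / x * besselJ (θ + 1) x - besselJ θ x by
        rw [besselJ_recurrence θ hx0]; ring]
      exact abs_div_mul_sub_le hx hb ha
    | pred n ih =>
      obtain ⟨C, hC⟩ := ih
      push_cast at hC ⊢
      set θ := ν - ⌈ν⌉ + (-(n : ℝ) - 1) with hθ
      refine ⟨max C (|2 * (θ + 1)| * C + C), fun x hx => ?_⟩
      obtain ⟨ha, hb⟩ := hC x hx
      have hx0 : 0 < x := by linarith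
      rw [show ν - ⌈ν⌉ + -(n : ℝ) = θ + 1 by rw [hθ]; ring] at ha hb
      rw [show θ + 1 + 1 = θ + 2 by ring] at hb
      refine ⟨le_trans ?_ (le_max_right _ _), ha.trans (le_max_left _ _)⟩
      rw [besselJ_recurrence θ hx0]
      exact abs_div_mul_sub_le hx ha hb
  obtain ⟨C, hC⟩ := hstep ⌈ν⌉
  exact ⟨C, fun x hx => by simpa using (hC x hx).1⟩

theorem exists_abs_besselJ_le_rpow (ν : ℝ) :
    ∃ C, ∀ x, 0 < x → x ≤ 1 → |besselJ ν x| ≤ C * x ^ ν := by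
  have hc : ContinuousOn (besselEntire ν) (Icc 0 1) := fun y _ =>
    (hasDerivAt_besselEntire ν y).continuousAt.continuousWithinAt
  obtain ⟨C, hC⟩ := isCompact_Icc.exists_bound_of_continuousOn hc
  refine ⟨(1 / 2) ^ ν * C, fun x hx hx1 => ?_⟩
  have h := hC ((x / 2) ^ 2) ⟨by positivity, by nlinarith⟩
  rw [Real.norm_eq_abs] at h
  rw [besselJ_eq_rpow_mul_besselEntire ν hx, abs_mul, abs_of_nonneg (by positivity),
    show x / 2 = 1 / 2 * x by ring, Real.mul_rpow (by norm_num) hx.le]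
  rw [show x / 2 = 1 / 2 * x by ring] at h
  calc (1 / 2) ^ ν * x ^ ν * |besselEntire ν ((1 / 2 * x) ^ 2)|
      ≤ (1 / 2) ^ ν * x ^ ν * C := by gcongr
    _ = _ := by ring

theorem exists_abs_rpow_mul_besselJ_le {μ ν q p : ℝ} (hq : q ≤ μ + ν) (hp : μ ≤ p) :
    ∃ C, 0 ≤ C ∧ ∀ x, 0 < x → |x ^ μ * besselJ ν x| ≤ C * (x ^ q + x ^ p) := by
  obtain ⟨C, hC⟩ := exists_abs_besselJ_le ν
  obtain ⟨D, hD⟩ := exists_abs_besselJ_le_rpow ν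
  have hC0 : 0 ≤ C := (abs_nonneg _).trans (hC 1 le_rfl)
  have hD0 : 0 ≤ D := by simpa using (abs_nonneg _).trans (hD 1 one_pos le_rfl)
  refine ⟨C + D, by positivity, fun x hx => ?_⟩
  rw [abs_mul, abs_of_pos (Real.rpow_pos_of_pos hx _)]
  have hq0 := (Real.rpow_pos_of_pos hx q).le
  have hp0 := (Real.rpow_pos_of_pos hx p).le
  have hμ0 := (Real.rpow_pos_of_pos hx μ).le
  rcases le_total x 1 with h | h
  · calc x ^ μ * |besselJ ν x| ≤ x ^ μ * (D * x ^ ν) := by gcongr; exact hD x hx h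
      _ = D * x ^ (μ + ν) := by rw [Real.rpow_add hx]; ring
      _ ≤ D * x ^ q := by
          exact mul_le_mul_of_nonneg_left (Real.rpow_le_rpow_of_exponent_ge hx h hq) hD0
      _ ≤ (C + D) * (x ^ q + x ^ p) := by
          nlinarith [mul_nonneg hC0 hq0, mul_nonneg hC0 hp0, mul_nonneg hD0 hp0]
  · calc x ^ μ * |besselJ ν x| ≤ x ^ μ * C := by gcongr; exact hC x h
      _ ≤ x ^ p * C := by gcongr
      _ ≤ (C + D) * (x ^ q + x ^ p) := by
          nlinarith [mul_nonneg hC0 hq0, mul_nonneg hD0 hq0, mul_nonneg hD0 hp0]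

/-! ### The Laplace transform of `x ^ μ * J_ν x` -/

/-- The Laplace transform of `x ^ μ * J_ν x`. -/
def besselLaplace (μ ν s : ℝ) : ℝ :=
  ∫ x in Ioi (0 : ℝ), Real.exp (-s * x) * (x ^ μ * besselJ ν x)

/-- The Mellin transform of `J_ν` at `μ + 1`. -/
def besselMoment (μ ν : ℝ) : ℝ :=
  2 ^ μ * Real.Gamma ((ν + μ + 1) / 2) * (Real.Gamma ((ν - μ + 1) / 2))⁻¹

theorem besselMoment_eq (μ ν : ℝ) :
    besselMoment μ ν = (ν + 1 - μ) * besselMoment (μ - 1) (ν + 1) := by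
  rw [besselMoment, besselMoment, inv_Gamma_eq_mul_inv_Gamma_add_one ((ν - μ + 1) / 2),
    show (ν + 1 - (μ - 1) + 1) / 2 = (ν - μ + 1) / 2 + 1 by ring,
    show ν + 1 + (μ - 1) + 1 = ν + μ + 1 by ring, Real.rpow_sub two_pos, Real.rpow_one]
  ring

theorem continuousOn_rpow_Ioi (a : ℝ) : ContinuousOn (fun x : ℝ => x ^ a) (Ioi 0) := fun _ hx =>
  (Real.continuousAt_rpow_const _ _ (Or.inl (ne_of_gt hx))).continuousWithinAt

theorem continuousOn_rpow_mul_besselJ (μ ν : ℝ) :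
    ContinuousOn (fun x : ℝ => x ^ μ * besselJ ν x) (Ioi 0) :=
  (continuousOn_rpow_Ioi μ).mul (continuousOn_besselJ ν)

theorem integrableOn_exp_mul_rpow {s q : ℝ} (hs : 0 < s) (hq : -1 < q) :
    IntegrableOn (fun x : ℝ => Real.exp (-s * x) * x ^ q) (Ioi 0) := by
  have h := integrableOn_rpow_mul_exp_neg_mul_rpow hq one_pos hs
  simp only [Real.rpow_one] at h
  exact h.congr_fun (fun x _ => mul_comm _ _) measurableSet_Ioi

theorem integral_exp_mul_rpow {s q : ℝ} (hs : 0 < s) (hq : -1 < q) :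
    ∫ x in Ioi (0 : ℝ), Real.exp (-s * x) * x ^ q = s ^ (-(q + 1)) * Real.Gamma (q + 1) := by
  have h := Real.integral_rpow_mul_exp_neg_mul_Ioi (show 0 < q + 1 by linarith) hs
  rw [one_div, Real.inv_rpow hs.le, ← Real.rpow_neg hs.le] at h
  rw [← h]
  refine setIntegral_congr_fun measurableSet_Ioi fun x _ => ?_
  simp only [add_sub_cancel_right, neg_mul]
  ring

theorem integrableOn_exp_mul_rpow_mul_besselJ {μ ν s : ℝ} (hs : 0 < s) (h : -1 < μ + ν) :
    IntegrableOn (fun x : ℝ => Real.exp (-s * x) * (x ^ μ * besselJ ν x)) (Ioi 0) := by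
  obtain ⟨C, -, hC⟩ := exists_abs_rpow_mul_besselJ_le (le_refl (μ + ν)) (le_max_left μ 0)
  have hp : (-1 : ℝ) < max μ 0 := lt_of_lt_of_le (by norm_num) (le_max_right _ _)
  refine Integrable.mono' (((integrableOn_exp_mul_rpow hs h).add
    (integrableOn_exp_mul_rpow hs hp)).const_mul C) ?_ ?_
  · exact (ContinuousOn.mul (by fun_prop) (continuousOn_rpow_mul_besselJ μ ν)).aestronglyMeasurable
      measurableSet_Ioi
  · refine (ae_restrict_iff' measurableSet_Ioi).mpr (Eventually.of_forall fun x hx => ?_)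
    rw [norm_mul, Real.norm_eq_abs, Real.norm_eq_abs, Real.abs_exp]
    calc _ ≤ Real.exp (-s * x) * (C * (x ^ (μ + ν) + x ^ max μ 0)) := by gcongr; exact hC x hx
      _ = _ := by simp only [Pi.add_apply]; ring

theorem exists_abs_besselLaplace_le {μ ν q p : ℝ} (hq : -1 < q) (hqν : q ≤ μ + ν) (hp : -1 < p)
    (hμp : μ ≤ p) :
    ∃ C, ∀ s, 0 < s → |besselLaplace μ ν s| ≤ C * (s ^ (-(q + 1)) + s ^ (-(p + 1))) := by
  obtain ⟨C, hC0, hC⟩ := exists_abs_rpow_mul_besselJ_le hqν hμp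
  refine ⟨C * (Real.Gamma (q + 1) + Real.Gamma (p + 1)), fun s hs => ?_⟩
  have hgq : 0 < Real.Gamma (q + 1) := Real.Gamma_pos_of_pos (by linarith)
  have hgp : 0 < Real.Gamma (p + 1) := Real.Gamma_pos_of_pos (by linarith)
  have hsq : 0 < s ^ (-(q + 1)) := Real.rpow_pos_of_pos hs _
  have hsp : 0 < s ^ (-(p + 1)) := Real.rpow_pos_of_pos hs _
  have hiq := integrableOn_exp_mul_rpow hs hq
  have hip := integrableOn_exp_mul_rpow hs hp
  have hle : |besselLaplace μ ν s| ≤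
      ∫ x in Ioi (0 : ℝ), C * (Real.exp (-s * x) * x ^ q + Real.exp (-s * x) * x ^ p) := by
    rw [← Real.norm_eq_abs, besselLaplace]
    refine norm_integral_le_of_norm_le ((hiq.add hip).const_mul C) ?_
    refine (ae_restrict_iff' measurableSet_Ioi).mpr (Eventually.of_forall fun x hx => ?_)
    rw [norm_mul, Real.norm_eq_abs, Real.norm_eq_abs, Real.abs_exp]
    calc _ ≤ Real.exp (-s * x) * (C * (x ^ q + x ^ p)) := by gcongr; exact hC x hx
      _ = _ := by ring
  rw [integral_const_mul, integral_add hiq hip, integral_exp_mul_rpow hs hq,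
    integral_exp_mul_rpow hs hp] at hle
  refine hle.trans ?_
  rw [mul_assoc]
  refine mul_le_mul_of_nonneg_left ?_ hC0
  nlinarith [mul_pos hsq hgp, mul_pos hsp hgq]

theorem besselLaplace_eq {μ ν s : ℝ} (hs : 0 < s) (h : -1 < μ + ν) :
    besselLaplace μ ν s =
      (ν + 1 - μ) * besselLaplace (μ - 1) (ν + 1) s + s * besselLaplace μ (ν + 1) s := by
  have i1 := integrableOn_exp_mul_rpow_mul_besselJ hs h
  have i2 := integrableOn_exp_mul_rpow_mul_besselJ (μ := μ - 1) (ν := ν + 1) hs (by linarith)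
  have i3 := integrableOn_exp_mul_rpow_mul_besselJ (μ := μ) (ν := ν + 1) hs (by linarith)
  set F : ℝ → ℝ := fun x => if x = 0 then 0 else Real.exp (-s * x) * (x ^ μ * besselJ (ν + 1) x)
    with hF
  have hF0 : F 0 = 0 := by simp [hF]
  have hFpos : ∀ x, 0 < x → F x = Real.exp (-s * x) * (x ^ μ * besselJ (ν + 1) x) :=
    fun x hx => if_neg hx.ne'
  have hq : 0 < μ + (ν + 1) := by linarith
  have hp : 0 < max μ 1 := lt_of_lt_of_le one_pos (le_max_right _ _)
  obtain ⟨C, -, hC⟩ := exists_abs_rpow_mul_besselJ_le (le_refl (μ + (ν + 1))) (le_max_left μ 1)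
  have hbound : ∀ x, 0 < x →
      ‖F x‖ ≤ C * (x ^ (μ + (ν + 1)) * Real.exp (-s * x) + x ^ max μ 1 * Real.exp (-s * x)) := by
    intro x hx
    rw [hFpos x hx, norm_mul, Real.norm_eq_abs, Real.norm_eq_abs, Real.abs_exp]
    calc _ ≤ Real.exp (-s * x) * (C * (x ^ (μ + (ν + 1)) + x ^ max μ 1)) := by
          gcongr; exact hC x hx
      _ = _ := by ring
  have htop : Tendsto F atTop (nhds 0) := by
    refine squeeze_zero_norm' ((eventually_gt_atTop 0).mono hbound) ?_
    simpa using ((tendsto_rpow_mul_exp_neg_mul_atTop_nhds_zero (μ + (ν + 1)) s hs).add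
      (tendsto_rpow_mul_exp_neg_mul_atTop_nhds_zero (max μ 1) s hs)).const_mul C
  have hcont : ContinuousWithinAt F (Ici 0) 0 := by
    rw [← continuousWithinAt_Ioi_iff_Ici, ContinuousWithinAt, hF0]
    refine squeeze_zero_norm' (eventually_nhdsWithin_of_forall hbound) ?_
    have hc : Continuous fun x : ℝ =>
        C * (x ^ (μ + (ν + 1)) * Real.exp (-s * x) + x ^ max μ 1 * Real.exp (-s * x)) := by
      have := Real.continuous_rpow_const hq.le
      have := Real.continuous_rpow_const hp.le
      fun_prop
    have := hc.tendsto 0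
    simp only [Real.zero_rpow hq.ne', Real.zero_rpow hp.ne', zero_mul, add_zero, mul_zero] at this
    exact this.mono_left nhdsWithin_le_nhds
  have hderiv : ∀ x ∈ Ioi (0 : ℝ), HasDerivAt F
      (Real.exp (-s * x) * (x ^ μ * besselJ ν x)
        - (ν + 1 - μ) * (Real.exp (-s * x) * (x ^ (μ - 1) * besselJ (ν + 1) x))
        - s * (Real.exp (-s * x) * (x ^ μ * besselJ (ν + 1) x))) x := by
    intro x hx
    have hx : 0 < x := hx
    have he : HasDerivAt (fun t : ℝ => Real.exp (-s * t)) (Real.exp (-s * x) * (-s * 1)) x :=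
      ((hasDerivAt_id x).const_mul (-s)).exp
    have hr : HasDerivAt (fun t : ℝ => t ^ μ) (μ * x ^ (μ - 1)) x :=
      Real.hasDerivAt_rpow_const (Or.inl hx.ne')
    have h := (he.mul (hr.mul (hasDerivAt_besselJ_add_one ν hx))).congr_of_eventuallyEq
      (f₁ := F) (by filter_upwards [lt_mem_nhds hx] with t ht using hFpos t ht)
    refine h.congr_deriv ?_
    rw [Real.rpow_sub hx, Real.rpow_one]
    simp only [Pi.mul_apply]
    field_simp
    ring
  have hint := integral_Ioi_of_hasDerivAt_of_tendsto hcont hderiv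
    ((i1.sub (i2.const_mul (ν + 1 - μ))).sub (i3.const_mul s)) htop
  have e1 := integral_sub (i1.sub (i2.const_mul (ν + 1 - μ))) (i3.const_mul s)
  have e2 := integral_sub i1 (i2.const_mul (ν + 1 - μ))
  simp only [Pi.sub_apply] at e1 e2
  rw [e1, e2, integral_const_mul, integral_const_mul, hF0] at hint
  simp only [besselLaplace]
  linarith

theorem tendsto_rpow_nhdsWithin_zero {a : ℝ} (ha : 0 < a) :
    Tendsto (fun s : ℝ => s ^ a) (nhdsWithin 0 (Ioi 0)) (nhds 0) := by
  have := (Real.continuous_rpow_const ha.le).tendsto (0 : ℝ)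
  rw [Real.zero_rpow ha.ne'] at this
  exact this.mono_left nhdsWithin_le_nhds

theorem exists_tendsto_pow_mul_besselLaplace {μ ν : ℝ} (h : -1 < μ + ν) :
    ∃ n : ℕ, Tendsto (fun s => s ^ (n + 1) * besselLaplace μ (ν + n) s)
      (nhdsWithin 0 (Ioi 0)) (nhds 0) := by
  obtain ⟨n, hn⟩ := exists_nat_gt (max (μ + ν) (max μ 0))
  have hn1 : μ + ν < n := (le_max_left _ _).trans_lt hn
  have hn2 : max μ 0 < n := (le_max_right _ _).trans_lt hn
  have hp : (-1 : ℝ) < max μ 0 := lt_of_lt_of_le (by norm_num) (le_max_right _ _)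
  obtain ⟨C, hC⟩ := exists_abs_besselLaplace_le (μ := μ) (ν := ν + n) (q := μ + ν) (p := max μ 0)
    h (by have : (0 : ℝ) ≤ n := n.cast_nonneg
          linarith) hp (le_max_left _ _)
  refine ⟨n, squeeze_zero_norm' (a := fun s : ℝ =>
    C * (s ^ ((n : ℝ) - (μ + ν)) + s ^ ((n : ℝ) - max μ 0))) ?_ ?_⟩
  · filter_upwards [self_mem_nhdsWithin] with s hs
    have hs : 0 < s := hs
    have hpow : ∀ a : ℝ, s ^ ((n : ℝ) - a) = s ^ (n + 1) * s ^ (-(a + 1)) := by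
      intro a
      rw [← Real.rpow_natCast, ← Real.rpow_add hs]
      push_cast
      ring_nf
    rw [hpow, hpow, norm_mul, Real.norm_eq_abs, Real.norm_eq_abs, abs_of_pos (pow_pos hs _)]
    calc _ ≤ s ^ (n + 1) * (C * (s ^ (-(μ + ν + 1)) + s ^ (-(max μ 0 + 1)))) := by
          gcongr; exact hC s hs
      _ = _ := by ring
  · simpa using ((tendsto_rpow_nhdsWithin_zero (sub_pos.mpr hn1)).add
      (tendsto_rpow_nhdsWithin_zero (sub_pos.mpr hn2))).const_mul C

/-- Convergence of the Laplace transform at `0⁺` propagates from `μ - 1` to `μ`. -/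
theorem tendsto_besselLaplace_of_sub_one {μ : ℝ}
    (ih : ∀ ν, -1 < μ - 1 + ν → Tendsto (besselLaplace (μ - 1) ν) (nhdsWithin 0 (Ioi 0))
      (nhds (besselMoment (μ - 1) ν)))
    {ν : ℝ} (h : -1 < μ + ν) :
    Tendsto (besselLaplace μ ν) (nhdsWithin 0 (Ioi 0)) (nhds (besselMoment μ ν)) := by
  have hid : Tendsto (fun s : ℝ => s) (nhdsWithin 0 (Ioi 0)) (nhds 0) :=
    tendsto_id.mono_left nhdsWithin_le_nhds
  have hdown : ∀ n : ℕ, ∀ ν : ℝ, -1 < μ + ν →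
      Tendsto (fun s => s ^ (n + 1) * besselLaplace μ (ν + n) s) (nhdsWithin 0 (Ioi 0)) (nhds 0) →
      Tendsto (fun s => s * besselLaplace μ ν s) (nhdsWithin 0 (Ioi 0)) (nhds 0) := by
    intro n
    induction n with
    | zero => intro ν _ h0; simpa using h0
    | succ n hn =>
      intro ν hν hlim
      have hn0 : (0 : ℝ) ≤ n := n.cast_nonneg
      refine hn ν hν ?_
      have h1 := ((hid.pow (n + 1)).mul
        ((ih (ν + n + 1) (by linarith)).const_mul (ν + n + 1 - μ))).add hlim
      rw [zero_pow n.succ_ne_zero, zero_mul, zero_add] at h1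
      refine h1.congr' ?_
      filter_upwards [self_mem_nhdsWithin] with s hs
      rw [besselLaplace_eq (μ := μ) (ν := ν + n) hs (by linarith)]
      push_cast
      rw [← add_assoc, pow_succ s (n + 1)]
      ring
  obtain ⟨n, hn⟩ := exists_tendsto_pow_mul_besselLaplace (μ := μ) (ν := ν + 1) (by linarith)
  have h2 := ((ih (ν + 1) (by linarith)).const_mul (ν + 1 - μ)).add
    (hdown n (ν + 1) (by linarith) hn)
  rw [add_zero, ← besselMoment_eq] at h2
  refine h2.congr' ?_
  filter_upwards [self_mem_nhdsWithin] with s hs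
  rw [besselLaplace_eq hs h]

/-! ### The absolutely convergent range `μ < -1` -/

theorem integral_rpow_mul_besselJ_mul_exp_neg_mul_sq {ν p : ℝ} (hν : -1 < ν) (hp : 0 < p) :
    ∫ x in Ioi (0 : ℝ), x ^ (ν + 1) * besselJ ν x * Real.exp (-p * x ^ 2) =
      (2 * p) ^ (-(ν + 1)) * Real.exp (-(1 / 4 * p⁻¹)) := by
  set F : ℕ → ℝ → ℝ := fun k x => besselCoeff ν k * (1 / 2) ^ (ν + 2 * (k : ℝ)) *
    (x ^ (2 * ν + 2 * k + 1) * Real.exp (-p * x ^ 2)) with hF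
  have hexp : ∀ k : ℕ, -1 < 2 * ν + 2 * (k : ℝ) + 1 := fun k => by
    have : (0 : ℝ) ≤ k := k.cast_nonneg
    linarith
  have hint : ∀ k, Integrable (F k) (volume.restrict (Ioi 0)) := fun k =>
    (integrableOn_rpow_mul_exp_neg_mul_sq hp (hexp k)).const_mul _
  have hval : ∀ k : ℕ, (1 / 2 : ℝ) ^ (ν + 2 * (k : ℝ)) *
      (∫ x in Ioi (0 : ℝ), x ^ (2 * ν + 2 * k + 1) * Real.exp (-p * x ^ 2)) =
      (2 * p) ^ (-(ν + 1)) * (1 / 4 * p⁻¹) ^ k * Real.Gamma (ν + k + 1) := by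
    intro k
    have h := integral_rpow_mul_exp_neg_mul_rpow two_pos (hexp k) hp
    simp only [Real.rpow_two] at h
    rw [h, show (2 * ν + 2 * (k : ℝ) + 1 + 1) / 2 = ν + k + 1 by ring,
      show -(2 * ν + 2 * (k : ℝ) + 1 + 1) / 2 = -(ν + 1) + -(k : ℝ) by ring,
      Real.rpow_add hp, Real.rpow_neg hp.le (k : ℝ), Real.rpow_natCast,
      Real.mul_rpow zero_le_two hp.le, mul_pow, inv_pow, Real.rpow_add (by norm_num),
      show 2 * (k : ℝ) = ((2 * k : ℕ) : ℝ) by push_cast; ring, Real.rpow_natCast, pow_mul,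
      Real.rpow_neg zero_le_two, Real.rpow_add two_pos, Real.rpow_one, one_div,
      Real.inv_rpow zero_le_two]
    norm_num
    ring
  have hG : ∀ k : ℕ, 0 < Real.Gamma (ν + k + 1) := fun k => by
    have : (0 : ℝ) ≤ k := k.cast_nonneg
    exact Real.Gamma_pos_of_pos (by linarith)
  have hFi : ∀ k, ∫ x in Ioi (0 : ℝ), F k x =
      (2 * p) ^ (-(ν + 1)) * ((-(1 / 4 * p⁻¹)) ^ k / k.factorial) := by
    intro k
    have hGk := hG k
    simp only [hF]
    rw [integral_const_mul, mul_assoc, hval, besselCoeff, neg_pow (1 / 4 * p⁻¹)]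
    field_simp
  have hFn : ∀ k, ∫ x in Ioi (0 : ℝ), ‖F k x‖ =
      (2 * p) ^ (-(ν + 1)) * ((1 / 4 * p⁻¹) ^ k / k.factorial) := by
    intro k
    have hGk := hG k
    have : ∫ x in Ioi (0 : ℝ), ‖F k x‖ = ∫ x in Ioi (0 : ℝ),
        |besselCoeff ν k| * (1 / 2) ^ (ν + 2 * (k : ℝ)) *
          (x ^ (2 * ν + 2 * k + 1) * Real.exp (-p * x ^ 2)) := by
      refine setIntegral_congr_fun measurableSet_Ioi fun x hx => ?_
      have hx : 0 < x := hx
      simp only [hF, norm_mul, Real.norm_eq_abs, Real.abs_exp]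
      rw [abs_of_pos (Real.rpow_pos_of_pos hx _), abs_of_pos (Real.rpow_pos_of_pos one_half_pos _)]
    rw [this, integral_const_mul, mul_assoc, hval, besselCoeff, abs_div, abs_pow, abs_neg, abs_one,
      one_pow, abs_of_pos (by positivity)]
    field_simp
  have hsum : Summable fun k => ∫ x in Ioi (0 : ℝ), ‖F k x‖ := by
    simp only [hFn]
    exact (Real.summable_pow_div_factorial _).mul_left _
  have hts := (hasSum_integral_of_summable_integral_norm hint hsum).tsum_eq
  simp only [hFi] at hts
  have hser : Real.exp (-(1 / 4 * p⁻¹)) = ∑' k : ℕ, (-(1 / 4 * p⁻¹)) ^ k / k.factorial := by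
    rw [Real.exp_eq_exp_ℝ, NormedSpace.exp_eq_tsum_div]
  rw [tsum_mul_left, ← hser] at hts
  rw [hts]
  refine setIntegral_congr_fun measurableSet_Ioi fun x hx => ?_
  have hx : 0 < x := hx
  simp only [hF, besselJ]
  rw [← tsum_mul_left, ← tsum_mul_right]
  refine tsum_congr fun k => ?_
  rw [show x / 2 = 1 / 2 * x by ring, Real.mul_rpow (by norm_num) hx.le,
    show 2 * ν + 2 * (k : ℝ) + 1 = (ν + 1) + (ν + 2 * k) by ring, Real.rpow_add hx (ν + 1),
    besselCoeff]
  ring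

theorem integrableOn_rpow_mul_besselJ {μ ν : ℝ} (hμ : μ < -1) (h : -1 < μ + ν) :
    IntegrableOn (fun x : ℝ => x ^ μ * besselJ ν x) (Ioi 0) := by
  obtain ⟨C, hC⟩ := exists_abs_besselJ_le ν
  obtain ⟨D, hD⟩ := exists_abs_besselJ_le_rpow ν
  have hcont := continuousOn_rpow_mul_besselJ μ ν
  rw [← Ioc_union_Ioi_eq_Ioi zero_le_one]
  refine IntegrableOn.union ?_ ?_
  · have hi : IntegrableOn (fun x : ℝ => x ^ (μ + ν)) (Ioc 0 1) :=
      (intervalIntegrable_iff_integrableOn_Ioc_of_le zero_le_one).1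
        (intervalIntegral.intervalIntegrable_rpow' h)
    refine Integrable.mono' (hi.const_mul D)
      ((hcont.mono Ioc_subset_Ioi_self).aestronglyMeasurable measurableSet_Ioc) ?_
    refine (ae_restrict_iff' measurableSet_Ioc).mpr (Eventually.of_forall fun x hx => ?_)
    have hx0 : 0 < x := hx.1
    rw [norm_mul, Real.norm_eq_abs, Real.norm_eq_abs, abs_of_pos (Real.rpow_pos_of_pos hx0 _)]
    calc _ ≤ x ^ μ * (D * x ^ ν) := by gcongr; exact hD x hx0 hx.2
      _ = _ := by rw [Real.rpow_add hx0]; ring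
  · refine Integrable.mono' ((integrableOn_Ioi_rpow_of_lt hμ one_pos).const_mul C)
      ((hcont.mono (Ioi_subset_Ioi zero_le_one)).aestronglyMeasurable measurableSet_Ioi) ?_
    refine (ae_restrict_iff' measurableSet_Ioi).mpr (Eventually.of_forall fun x hx => ?_)
    have hx1 : 1 < x := hx
    have hx0 : 0 < x := one_pos.trans hx1
    rw [norm_mul, Real.norm_eq_abs, Real.norm_eq_abs, abs_of_pos (Real.rpow_pos_of_pos hx0 _)]
    calc _ ≤ x ^ μ * C := by gcongr; exact hC x hx1.le
      _ = _ := by ring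

theorem integral_rpow_mul_exp_neg_mul_inv {a : ℝ} (ha : 0 < a) :
    ∫ p in Ioi (0 : ℝ), p ^ (-a - 1) * Real.exp (-(1 / 4 * p⁻¹)) = 4 ^ a * Real.Gamma a := by
  have h := integral_comp_rpow_Ioi (fun y : ℝ => y ^ (a - 1) * Real.exp (-(1 / 4 * y)))
    (show (-1 : ℝ) ≠ 0 by norm_num)
  rw [Real.integral_rpow_mul_exp_neg_mul_Ioi ha (by norm_num)] at h
  norm_num only at h
  rw [← h]
  refine setIntegral_congr_fun measurableSet_Ioi fun p hp => ?_
  have hp : 0 < p := hp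
  simp only [smul_eq_mul, one_mul]
  rw [← Real.rpow_mul hp.le, ← mul_assoc, ← Real.rpow_add hp, Real.rpow_neg_one]
  ring_nf

theorem integral_rpow_mul_besselJ {μ ν : ℝ} (hμ : μ < -1) (h : -1 < μ + ν) :
    ∫ x in Ioi (0 : ℝ), x ^ μ * besselJ ν x = besselMoment μ ν := by
  set c : ℝ := (ν - μ + 1) / 2 with hc
  have hc0 : 0 < c := by rw [hc]; linarith
  have hG : 0 < Real.Gamma c := Real.Gamma_pos_of_pos hc0
  set f : ℝ → ℝ → ℝ := fun x p =>
    x ^ (ν + 1) * besselJ ν x * (p ^ (c - 1) * Real.exp (-(x ^ 2 * p))) with hf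
  have hinner : ∀ x, 0 < x →
      x ^ (ν + 1) * ∫ p in Ioi (0 : ℝ), p ^ (c - 1) * Real.exp (-(x ^ 2 * p)) =
        Real.Gamma c * x ^ μ := by
    intro x hx
    rw [Real.integral_rpow_mul_exp_neg_mul_Ioi hc0 (by positivity), one_div,
      Real.inv_rpow (by positivity), ← Real.rpow_two, ← Real.rpow_mul hx.le,
      ← Real.rpow_neg hx.le, ← mul_assoc, ← Real.rpow_add hx, mul_comm]
    congr 2
    rw [hc]; ring
  have hcont : ContinuousOn (Function.uncurry f) (Ioi 0 ×ˢ Ioi 0) := by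
    have h1 : ContinuousOn (fun z : ℝ × ℝ => z.1 ^ (ν + 1) * besselJ ν z.1) (Ioi 0 ×ˢ Ioi 0) :=
      (continuousOn_rpow_mul_besselJ (ν + 1) ν).comp continuousOn_fst fun z hz => hz.1
    have h2 : ContinuousOn (fun z : ℝ × ℝ => z.2 ^ (c - 1)) (Ioi 0 ×ˢ Ioi 0) :=
      (continuousOn_rpow_Ioi (c - 1)).comp continuousOn_snd fun z hz => hz.2
    exact h1.mul (h2.mul (by fun_prop))
  have hint : Integrable (Function.uncurry f)
      ((volume.restrict (Ioi 0)).prod (volume.restrict (Ioi 0))) := by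
    rw [integrable_prod_iff (by
      rw [Measure.prod_restrict]
      exact hcont.aestronglyMeasurable (measurableSet_Ioi.prod measurableSet_Ioi))]
    constructor
    · refine (ae_restrict_iff' measurableSet_Ioi).mpr (Eventually.of_forall fun x hx => ?_)
      have hx : 0 < x := hx
      have := integrableOn_rpow_mul_exp_neg_mul_rpow (s := c - 1) (b := x ^ 2)
        (by linarith) one_pos (by positivity)
      simp only [Real.rpow_one, neg_mul] at this
      exact this.const_mul (x ^ (ν + 1) * besselJ ν x)
    · refine ((integrableOn_rpow_mul_besselJ hμ h).norm.const_mul (Real.Gamma c)).congr ?_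
      refine (ae_restrict_iff' measurableSet_Ioi).mpr (Eventually.of_forall fun x hx => ?_)
      have hx : 0 < x := hx
      have : ∫ p in Ioi (0 : ℝ), ‖Function.uncurry f (x, p)‖ =
          ∫ p in Ioi (0 : ℝ), x ^ (ν + 1) * |besselJ ν x| *
            (p ^ (c - 1) * Real.exp (-(x ^ 2 * p))) := by
        refine setIntegral_congr_fun measurableSet_Ioi fun p hp => ?_
        have hp : 0 < p := hp
        simp only [hf, Function.uncurry_apply_pair, norm_mul, Real.norm_eq_abs, Real.abs_exp,
          abs_of_pos (Real.rpow_pos_of_pos hp _), abs_of_pos (Real.rpow_pos_of_pos hx _)]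
      simp only [this]
      rw [integral_const_mul, norm_mul, Real.norm_eq_abs, Real.norm_eq_abs,
        abs_of_pos (Real.rpow_pos_of_pos hx _)]
      linear_combination -|besselJ ν x| * hinner x hx
  have hswap := integral_integral_swap hint
  have hL : ∫ x in Ioi (0 : ℝ), ∫ p in Ioi (0 : ℝ), f x p =
      Real.Gamma c * ∫ x in Ioi (0 : ℝ), x ^ μ * besselJ ν x := by
    rw [← integral_const_mul]
    refine setIntegral_congr_fun measurableSet_Ioi fun x hx => ?_
    simp only [hf]
    rw [integral_const_mul]
    linear_combination besselJ ν x * hinner x hx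
  have hR : ∫ p in Ioi (0 : ℝ), ∫ x in Ioi (0 : ℝ), f x p =
      2 ^ (-(ν + 1)) * (4 ^ ((ν + μ + 1) / 2) * Real.Gamma ((ν + μ + 1) / 2)) := by
    rw [← integral_rpow_mul_exp_neg_mul_inv (show 0 < (ν + μ + 1) / 2 by linarith),
      ← integral_const_mul]
    refine setIntegral_congr_fun measurableSet_Ioi fun p hp => ?_
    have hp : 0 < p := hp
    have hx : ∫ x in Ioi (0 : ℝ), f x p = ∫ x in Ioi (0 : ℝ),
        p ^ (c - 1) * (x ^ (ν + 1) * besselJ ν x * Real.exp (-p * x ^ 2)) := by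
      refine setIntegral_congr_fun measurableSet_Ioi fun x _ => ?_
      simp only [hf]
      rw [show -(x ^ 2 * p) = -p * x ^ 2 by ring]
      ring
    simp only [hx]
    rw [integral_const_mul, integral_rpow_mul_besselJ_mul_exp_neg_mul_sq (by linarith) hp,
      Real.mul_rpow zero_le_two hp.le,
      show -((ν + μ + 1) / 2) - 1 = (c - 1) + -(ν + 1) by rw [hc]; ring, Real.rpow_add hp]
    ring
  rw [hL, hR, show (4 : ℝ) = 2 ^ (2 : ℝ) by norm_num, ← Real.rpow_mul zero_le_two,
    ← mul_assoc, ← Real.rpow_add two_pos,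
    show -(ν + 1) + 2 * ((ν + μ + 1) / 2) = μ by ring] at hswap
  rw [besselMoment, ← hswap, ← hc]
  field_simp

theorem tendsto_besselLaplace_of_lt_neg_one {μ ν : ℝ} (hμ : μ < -1) (h : -1 < μ + ν) :
    Tendsto (besselLaplace μ ν) (nhdsWithin 0 (Ioi 0)) (nhds (besselMoment μ ν)) := by
  rw [← integral_rpow_mul_besselJ hμ h]
  refine tendsto_integral_filter_of_dominated_convergence (fun x => ‖x ^ μ * besselJ ν x‖)
    ?_ ?_ (integrableOn_rpow_mul_besselJ hμ h).norm ?_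
  · exact Eventually.of_forall fun s => (ContinuousOn.mul (by fun_prop)
      (continuousOn_rpow_mul_besselJ μ ν)).aestronglyMeasurable measurableSet_Ioi
  · filter_upwards [self_mem_nhdsWithin] with s hs
    refine (ae_restrict_iff' measurableSet_Ioi).mpr (Eventually.of_forall fun x hx => ?_)
    rw [norm_mul, Real.norm_eq_abs (Real.exp _), Real.abs_exp]
    refine mul_le_of_le_one_left (norm_nonneg _) (Real.exp_le_one_iff.mpr ?_)
    have := mul_pos (show 0 < s from hs) (show 0 < x from hx)
    linarith
  · refine Eventually.of_forall fun x => ?_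
    have hc : Continuous fun s : ℝ => Real.exp (-s * x) * (x ^ μ * besselJ ν x) := by fun_prop
    have := hc.tendsto 0
    simp only [neg_zero, zero_mul, Real.exp_zero, one_mul] at this
    exact this.mono_left nhdsWithin_le_nhds

theorem tendsto_besselLaplace {μ ν : ℝ} (h : -1 < μ + ν) :
    Tendsto (besselLaplace μ ν) (nhdsWithin 0 (Ioi 0)) (nhds (besselMoment μ ν)) := by
  have hind : ∀ n : ℕ, ∀ μ : ℝ, μ < n - 1 → ∀ ν : ℝ, -1 < μ + ν →
      Tendsto (besselLaplace μ ν) (nhdsWithin 0 (Ioi 0)) (nhds (besselMoment μ ν)) := by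
    intro n
    induction n with
    | zero =>
      intro μ hμ ν hν
      exact tendsto_besselLaplace_of_lt_neg_one (by simpa using hμ) hν
    | succ n ih =>
      intro μ hμ ν hν
      push_cast at hμ
      exact tendsto_besselLaplace_of_sub_one (ih (μ - 1) (by linarith)) hν
  obtain ⟨n, hn⟩ := exists_nat_gt (μ + 1)
  exact hind n μ (by linarith) ν h

/-- Abel limit of `∫₀^∞ x^μ J_ν(ωx) dx`, with the convention `1/Γ(z) = 0`
at nonpositive integers `z` (automatic since `Real.Gamma` vanishes there). -/
theorem abel_limit_power_besselJ (μ ν ω : ℝ) (h : -1 < μ + ν) (hω : 0 < ω) :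
    HasAbelLimit (fun x : ℝ => ((x ^ μ * besselJ ν (ω * x) : ℝ) : ℂ))
      (((2 ^ μ * Real.Gamma ((ν + μ + 1)/2) * (Real.Gamma ((ν - μ + 1)/2))⁻¹
          / ω ^ (μ + 1) : ℝ) : ℂ)) := by
  have hcomp : ∀ s x : ℝ, 0 < x →
      Complex.exp (-(s : ℂ) * (x : ℂ)) * ((x ^ μ * besselJ ν (ω * x) : ℝ) : ℂ) =
        ((ω ^ (-μ) * (Real.exp (-(s / ω) * (ω * x)) * ((ω * x) ^ μ * besselJ ν (ω * x))) : ℝ) :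
          ℂ) := by
    intro s x hx
    rw [Real.mul_rpow hω.le hx.le, Real.rpow_neg hω.le,
      show -(s / ω) * (ω * x) = -s * x by field_simp]
    have hω' : ω ^ μ ≠ 0 := (Real.rpow_pos_of_pos hω μ).ne'
    rw [show (ω ^ μ)⁻¹ * (Real.exp (-s * x) * (ω ^ μ * x ^ μ * besselJ ν (ω * x))) =
      Real.exp (-s * x) * (x ^ μ * besselJ ν (ω * x)) by field_simp]
    push_cast
    rfl
  constructor
  · intro s hs
    have hi := (integrableOn_Ioi_comp_mul_left_iff
      (fun x => Real.exp (-(s / ω) * x) * (x ^ μ * besselJ ν x)) 0 hω).2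
      (by rw [mul_zero]; exact integrableOn_exp_mul_rpow_mul_besselJ (div_pos hs hω) h)
    exact IntegrableOn.congr_fun ((hi.const_mul (ω ^ (-μ))).ofReal (𝕜 := ℂ))
      (fun x hx => (hcomp s x hx).symm) measurableSet_Ioi
  · have hval : ∀ s : ℝ,
        ∫ x in Ioi (0 : ℝ), Complex.exp (-(s : ℂ) * (x : ℂ)) *
          ((x ^ μ * besselJ ν (ω * x) : ℝ) : ℂ) =
        ((ω ^ (-μ) * (ω⁻¹ * besselLaplace μ ν (s / ω)) : ℝ) : ℂ) := by
      intro s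
      rw [setIntegral_congr_fun measurableSet_Ioi fun x hx => hcomp s x hx, integral_complex_ofReal,
        integral_const_mul, integral_comp_mul_left_Ioi
          (fun x => Real.exp (-(s / ω) * x) * (x ^ μ * besselJ ν x)) 0 hω, mul_zero, smul_eq_mul,
        besselLaplace]
    simp only [hval]
    refine (Complex.continuous_ofReal.tendsto _).comp ?_
    have hdiv : Tendsto (fun s : ℝ => s / ω) (nhdsWithin 0 (Ioi 0)) (nhdsWithin 0 (Ioi 0)) := by
      refine tendsto_nhdsWithin_iff.mpr ⟨?_, ?_⟩
      · have : Tendsto (fun s : ℝ => s / ω) (nhds 0) (nhds (0 / ω)) :=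
          (continuous_id.div_const ω).tendsto 0
        rw [zero_div] at this
        exact this.mono_left nhdsWithin_le_nhds
      · filter_upwards [self_mem_nhdsWithin] with s hs using div_pos hs hω
    have hlim := (((tendsto_besselLaplace h).comp hdiv).const_mul ω⁻¹).const_mul (ω ^ (-μ))
    have hL : ω ^ (-μ) * (ω⁻¹ * besselMoment μ ν) = 2 ^ μ * Real.Gamma ((ν + μ + 1)/2) *
        (Real.Gamma ((ν - μ + 1)/2))⁻¹ / ω ^ (μ + 1) := by
      rw [besselMoment, Real.rpow_add hω, Real.rpow_one, Real.rpow_neg hω.le]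
      field_simp
    rwa [hL] at hlim

end
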